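/- arXiv:2511.01037 — 2 statements merged into one kernel-verified Lean document; each statement's English description precedes it below -/
import Mathlib

section
/- Fix q > 0 and p ∈ ℝ, and let g and h be independent standard Gaussian random variables. Then lim_{c → ∞} c·( (c/2)·(1 − pq/c²) − (1/c)·𝔼_h[ log 𝔼_g[ exp( c·| √(1 − q/c²)·g + (√q·h)/c | ) ] ] ) = ((1 − p)·q)/2 − 𝔼_h[ log( 2·cosh(√q·h) ) ], where the limit is taken over c > √q. -/
open Real MeasureTheory ProbabilityTheory Filter

lemma integrable_exp_affine_gaussianReal (s m : ℝ) :
    Integrable (fun x => Real.exp (s * x + m)) (gaussianReal 0 1) := by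
  simp only [Real.exp_add]
  exact (integrable_exp_mul_gaussianReal s).mul_const _

lemma integral_exp_affine_gaussianReal (s m : ℝ) :
    ∫ x, Real.exp (s * x + m) ∂(gaussianReal 0 1) = Real.exp (s ^ 2 / 2) * Real.exp m := by
  have h := congrFun (mgf_id_gaussianReal (μ := 0) (v := 1)) s
  simp only [mgf, id] at h
  simp only [Real.exp_add, integral_mul_const, h]
  simp

lemma integrable_two_mul_cosh_affine_gaussianReal (s m : ℝ) :
    Integrable (fun x => 2 * Real.cosh (s * x + m)) (gaussianReal 0 1) := by
  have h := (integrable_exp_affine_gaussianReal s m).add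
    (integrable_exp_affine_gaussianReal (-s) (-m))
  refine h.congr (ae_of_all _ fun x => ?_)
  simp only [Pi.add_apply, Real.cosh_eq]
  ring_nf

lemma integral_two_mul_cosh_affine_gaussianReal (s m : ℝ) :
    ∫ x, 2 * Real.cosh (s * x + m) ∂(gaussianReal 0 1)
      = Real.exp (s ^ 2 / 2) * (2 * Real.cosh m) := by
  have h := integral_add (integrable_exp_affine_gaussianReal s m)
    (integrable_exp_affine_gaussianReal (-s) (-m))
  rw [integral_exp_affine_gaussianReal, integral_exp_affine_gaussianReal] at h
  calc _ = ∫ x, (Real.exp (s * x + m) + Real.exp (-s * x + -m)) ∂(gaussianReal 0 1) := by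
        congr 1 with x
        rw [Real.cosh_eq]
        ring_nf
    _ = _ := by
        rw [h, Real.cosh_eq]
        ring_nf

lemma exp_abs_le_two_mul_cosh (x : ℝ) : Real.exp |x| ≤ 2 * Real.cosh x := by
  rw [← Real.cosh_abs, Real.cosh_eq]
  linarith [Real.exp_pos (-|x|)]

lemma two_mul_cosh_sub_one_le_exp_abs (x : ℝ) : 2 * Real.cosh x - 1 ≤ Real.exp |x| := by
  rw [← Real.cosh_abs, Real.cosh_eq]
  have : Real.exp (-|x|) ≤ 1 := Real.exp_le_one_iff.2 (by simp)
  linarith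

lemma integrable_exp_abs_affine_gaussianReal (s m : ℝ) :
    Integrable (fun x => Real.exp |s * x + m|) (gaussianReal 0 1) := by
  refine (integrable_two_mul_cosh_affine_gaussianReal s m).mono'
    (by fun_prop) (ae_of_all _ fun x => ?_)
  rw [Real.norm_of_nonneg (Real.exp_pos _).le]
  exact exp_abs_le_two_mul_cosh _

lemma integral_exp_abs_affine_gaussianReal_le (s m : ℝ) :
    ∫ x, Real.exp |s * x + m| ∂(gaussianReal 0 1) ≤ Real.exp (s ^ 2 / 2) * (2 * Real.cosh m) := by
  rw [← integral_two_mul_cosh_affine_gaussianReal]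
  exact integral_mono (integrable_exp_abs_affine_gaussianReal s m)
    (integrable_two_mul_cosh_affine_gaussianReal s m) fun x => exp_abs_le_two_mul_cosh _

lemma le_integral_exp_abs_affine_gaussianReal (s m : ℝ) :
    Real.exp (s ^ 2 / 2) * (2 * Real.cosh m) - 1
      ≤ ∫ x, Real.exp |s * x + m| ∂(gaussianReal 0 1) := by
  have h := integral_mono
    ((integrable_two_mul_cosh_affine_gaussianReal s m).sub (integrable_const 1))
    (integrable_exp_abs_affine_gaussianReal s m) fun x => two_mul_cosh_sub_one_le_exp_abs _
  simp only [Pi.sub_apply] at h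
  rw [integral_sub (integrable_two_mul_cosh_affine_gaussianReal s m) (integrable_const 1),
    integral_two_mul_cosh_affine_gaussianReal] at h
  simpa using h

/-- The error in replacing `exp |x|` by `2 cosh x` under the Gaussian expectation is, after
taking logarithms, at most `exp (-s² / 2)`, uniformly in the mean `m`. -/
lemma abs_log_integral_exp_abs_sub_le (s m : ℝ) :
    |Real.log (∫ x, Real.exp |s * x + m| ∂(gaussianReal 0 1))
      - (s ^ 2 / 2 + Real.log (2 * Real.cosh m))| ≤ Real.exp (-(s ^ 2 / 2)) := by
  have hup := integral_exp_abs_affine_gaussianReal_le s m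
  have hlow := le_integral_exp_abs_affine_gaussianReal s m
  set I := ∫ x, Real.exp |s * x + m| ∂(gaussianReal 0 1)
  have hE : 1 ≤ Real.exp (s ^ 2 / 2) := Real.one_le_exp (by positivity)
  have hcosh := Real.one_le_cosh m
  set E := Real.exp (s ^ 2 / 2) with hEdef
  set A := E * (2 * Real.cosh m) with hA
  have hlogA : s ^ 2 / 2 + Real.log (2 * Real.cosh m) = Real.log A := by
    rw [hA, Real.log_mul (x := E) (by positivity) (by positivity), hEdef, Real.log_exp]
  have hAE : E ≤ A - 1 := by nlinarith
  have hI : E ≤ I := hAE.trans hlow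
  have hEpos : 0 < E := by linarith
  have hIpos : 0 < I := by linarith
  have hApos : 0 < A := by linarith
  rw [hlogA, abs_sub_comm, abs_of_nonneg (sub_nonneg.2 (Real.log_le_log hIpos hup)),
    ← Real.log_div hApos.ne' hIpos.ne', Real.exp_neg]
  calc Real.log (A / I) ≤ A / I - 1 := Real.log_le_sub_one_of_pos (by positivity)
    _ = (A - I) / I := by field_simp
    _ ≤ 1 / E := by
        gcongr
        linarith
    _ = E⁻¹ := one_div _

lemma integrable_log_two_mul_cosh_gaussianReal (r : ℝ) :
    Integrable (fun x => Real.log (2 * Real.cosh (r * x))) (gaussianReal 0 1) := by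
  have h := integrable_two_mul_cosh_affine_gaussianReal r 0
  simp only [add_zero] at h
  have hm : Measurable fun x => Real.log (2 * Real.cosh (r * x)) :=
    Measurable.log (by fun_prop)
  refine h.mono' hm.aestronglyMeasurable (ae_of_all _ fun x => ?_)
  have hc := Real.one_le_cosh (r * x)
  rw [Real.norm_of_nonneg (Real.log_nonneg (by linarith))]
  exact Real.log_le_self (by positivity)

lemma abs_integral_log_integral_exp_abs_sub_le (s r : ℝ) :
    |∫ h, Real.log (∫ g, Real.exp |s * g + r * h| ∂(gaussianReal 0 1)) ∂(gaussianReal 0 1)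
      - (s ^ 2 / 2 + ∫ h, Real.log (2 * Real.cosh (r * h)) ∂(gaussianReal 0 1))|
      ≤ Real.exp (-(s ^ 2 / 2)) := by
  set F : ℝ → ℝ := fun h => Real.log (∫ g, Real.exp |s * g + r * h| ∂(gaussianReal 0 1))
  set G : ℝ → ℝ := fun h => s ^ 2 / 2 + Real.log (2 * Real.cosh (r * h))
  have hFG : ∀ h, ‖F h - G h‖ ≤ Real.exp (-(s ^ 2 / 2)) :=
    fun h => abs_log_integral_exp_abs_sub_le s (r * h)
  have hL := integrable_log_two_mul_cosh_gaussianReal r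
  have hG : Integrable G (gaussianReal 0 1) := (integrable_const _).add hL
  have hFm : AEStronglyMeasurable F (gaussianReal 0 1) := by
    have hc : Continuous fun z : ℝ × ℝ => Real.exp |s * z.2 + r * z.1| := by fun_prop
    exact (hc.stronglyMeasurable.integral_prod_right
      (ν := gaussianReal 0 1)).measurable.log.aestronglyMeasurable
  have hsub : Integrable (fun h => F h - G h) (gaussianReal 0 1) :=
    (integrable_const (Real.exp (-(s ^ 2 / 2)))).mono'
      (hFm.sub hG.aestronglyMeasurable) (ae_of_all _ hFG)
  have hF : Integrable F (gaussianReal 0 1) := by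
    refine (hsub.add hG).congr (ae_of_all _ fun h => ?_)
    simp
  have hGint : ∫ h, G h ∂(gaussianReal 0 1)
      = s ^ 2 / 2 + ∫ h, Real.log (2 * Real.cosh (r * h)) ∂(gaussianReal 0 1) := by
    rw [integral_add (integrable_const _) hL]
    simp
  rw [← hGint, ← integral_sub hF hG]
  simpa using norm_integral_le_of_norm_le_const (μ := gaussianReal 0 1) (ae_of_all _ hFG)

/-- Fix `q > 0` and `p ∈ ℝ`; let `g`, `h` be independent standard
Gaussians. Then, as `c → ∞` over `c > √q`,
`c ((c/2)(1 - pq/c²) - (1/c) 𝔼_h[log 𝔼_g[exp(c |√(1 - q/c²) g + √q h / c|)]])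
  → ((1 - p) q)/2 - 𝔼_h[log(2 cosh(√q h))]`. -/
theorem second_level_binary_side_limit (q p : ℝ) (hq : 0 < q) :
    Tendsto (fun c : ℝ => c *
        ((c / 2) * (1 - p * q / c ^ 2) -
          (1 / c) * ∫ h, Real.log
            (∫ g, Real.exp (c * |Real.sqrt (1 - q / c ^ 2) * g + Real.sqrt q * h / c|)
              ∂(gaussianReal 0 1)) ∂(gaussianReal 0 1)))
      (atTop ⊓ Filter.principal (Set.Ioi (Real.sqrt q)))
      (nhds (((1 - p) * q) / 2 -
        ∫ h, Real.log (2 * Real.cosh (Real.sqrt q * h)) ∂(gaussianReal 0 1))) := by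
  set L := ∫ h, Real.log (2 * Real.cosh (Real.sqrt q * h)) ∂(gaussianReal 0 1)
  rw [tendsto_iff_dist_tendsto_zero]
  have hbound : Tendsto (fun c : ℝ => Real.exp (-((c ^ 2 - q) / 2)))
      (atTop ⊓ Filter.principal (Set.Ioi (Real.sqrt q))) (nhds 0) := by
    refine Tendsto.mono_left ?_ inf_le_left
    refine Real.tendsto_exp_neg_atTop_nhds_zero.comp ?_
    exact (tendsto_atTop_add_const_right _ (-q)
      (tendsto_pow_atTop (two_ne_zero))).atTop_div_const two_pos
  refine squeeze_zero' (Eventually.of_forall fun _ => dist_nonneg) ?_ hbound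
  filter_upwards [mem_inf_of_right (mem_principal_self _)] with c hc
  have hc0 : 0 < c := (Real.sqrt_nonneg q).trans_lt hc
  have hqc : q < c ^ 2 := (Real.sqrt_lt' hc0).1 hc
  have hs : (c * Real.sqrt (1 - q / c ^ 2)) ^ 2 = c ^ 2 - q := by
    rw [mul_pow, Real.sq_sqrt (sub_nonneg.2 ((div_le_one (by positivity)).2 hqc.le))]
    field_simp
  have hexp : ∀ h g : ℝ, c * |Real.sqrt (1 - q / c ^ 2) * g + Real.sqrt q * h / c|
      = |c * Real.sqrt (1 - q / c ^ 2) * g + Real.sqrt q * h| := fun h g => by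
    rw [← abs_of_pos hc0, ← abs_mul, abs_of_pos hc0]
    congr 1
    field_simp
  simp only [hexp]
  have key := abs_integral_log_integral_exp_abs_sub_le
    (c * Real.sqrt (1 - q / c ^ 2)) (Real.sqrt q)
  rw [hs, abs_sub_comm] at key
  refine le_of_eq_of_le ?_ key
  rw [Real.dist_eq]
  congr 1
  field_simp
  ring
end

section
/- Fix p ∈ (0, 1), q > 0, κ ∈ ℝ, and α > 0, and let g and h be independent standard Gaussian random variables. Then lim_{c → ∞} c·( (c/2)·(1 − pq/c²) − (1/c)·𝔼_h[ log 𝔼_g[ exp( c·| √(1 − q/c²)·g + (√q·h)/c | ) ] ] + 1/c² − (α/c)·𝔼_h[ log 𝔼_g[ exp( −(c³/4)·max( √(1−p)·g + √p·h + κ, 0 )² ) ] ] ) = ((1 − p)·q)/2 − 𝔼_h[ log( 2·cosh(√q·h) ) ] − α·𝔼_h[ log( (1/2)·erfc( (√p·h + κ)/√(2(1 − p)) ) ) ], where the limit is taken over c > √q. -/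
open Real MeasureTheory ProbabilityTheory Filter

/-- The complementary error function `erfc x = (2/√π) ∫_x^∞ e^{-t²} dt`. -/
noncomputable def erfc (x : ℝ) : ℝ := (2 / Real.sqrt π) * ∫ t in Set.Ioi x, Real.exp (-t ^ 2)

/-- The correction `𝔼_g[exp(-c |√(1 - q/c²) g + m h/c|)]` by which `𝔼_g[exp(c |⋅|)]` falls short
of `2 𝔼_g[cosh(c ⋅)]`. -/
noncomputable def expNegAbsMean (q m c h : ℝ) : ℝ :=
  ∫ g, Real.exp (-(c * |Real.sqrt (1 - q / c ^ 2) * g + m * h / c|)) ∂(gaussianReal 0 1)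

theorem exp_abs_eq (x : ℝ) :
    Real.exp |x| = Real.exp x + Real.exp (-x) - Real.exp (-|x|) := by
  rcases abs_cases x with ⟨h, _⟩ | ⟨h, _⟩ <;> rw [h] <;> simp

theorem integral_exp_mul_stdGaussian (t : ℝ) :
    ∫ g, Real.exp (t * g) ∂(gaussianReal 0 1) = Real.exp (t ^ 2 / 2) := by
  have h := mgf_gaussianReal (p := gaussianReal 0 1) (X := id) (μ := 0) (v := 1) (by simp) t
  simpa [mgf] using h

theorem integrable_exp_neg_abs (q m c h : ℝ) (hc : 0 < c) :
    Integrable (fun g => Real.exp (-(c * |Real.sqrt (1 - q / c ^ 2) * g + m * h / c|)))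
      (gaussianReal 0 1) := by
  refine Integrable.mono' (integrable_const (1 : ℝ))
    (by fun_prop : Continuous _).aestronglyMeasurable (ae_of_all _ fun g => ?_)
  rw [Real.norm_eq_abs, Real.abs_exp, Real.exp_le_one_iff]
  have := abs_nonneg (Real.sqrt (1 - q / c ^ 2) * g + m * h / c)
  nlinarith

theorem expNegAbsMean_nonneg (q m c h : ℝ) : 0 ≤ expNegAbsMean q m c h :=
  integral_nonneg fun _ => (Real.exp_pos _).le

theorem expNegAbsMean_le_one (q m c h : ℝ) (hc : 0 < c) : expNegAbsMean q m c h ≤ 1 := by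
  have := integral_mono (integrable_exp_neg_abs q m c h hc)
    (integrable_const (μ := gaussianReal 0 1) (1 : ℝ)) (fun g => by
      rw [Real.exp_le_one_iff]
      have := abs_nonneg (Real.sqrt (1 - q / c ^ 2) * g + m * h / c)
      nlinarith)
  simpa [expNegAbsMean] using this

theorem stronglyMeasurable_expNegAbsMean (q m c : ℝ) :
    StronglyMeasurable (expNegAbsMean q m c) := by
  unfold expNegAbsMean
  apply StronglyMeasurable.integral_prod_right
  apply Continuous.stronglyMeasurable
  unfold Function.uncurry
  fun_prop

theorem integral_exp_abs_affine (q m c h : ℝ) (hc : 0 < c) (hqc : q ≤ c ^ 2) :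
    ∫ g, Real.exp (c * |Real.sqrt (1 - q / c ^ 2) * g + m * h / c|) ∂(gaussianReal 0 1) =
      Real.exp ((c ^ 2 - q) / 2) *
        (2 * Real.cosh (m * h) - Real.exp (-((c ^ 2 - q) / 2)) * expNegAbsMean q m c h) := by
  set s := Real.sqrt (1 - q / c ^ 2) with hs
  have hs2 : (c * s) ^ 2 = c ^ 2 - q := by
    rw [mul_pow, hs, Real.sq_sqrt (by rw [sub_nonneg, div_le_one (by positivity)]; exact hqc)]
    field_simp
  have key : ∀ g, Real.exp (c * |s * g + m * h / c|) =
      Real.exp (m * h) * Real.exp ((c * s) * g) + Real.exp (-(m * h)) * Real.exp (-(c * s) * g) -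
        Real.exp (-(c * |s * g + m * h / c|)) := by
    intro g
    have h1 : c * |s * g + m * h / c| = |c * s * g + m * h| := by
      rw [← abs_of_pos hc, ← abs_mul, abs_of_pos hc]
      congr 1
      field_simp
    rw [h1, exp_abs_eq, ← Real.exp_add, ← Real.exp_add]
    ring_nf
  have i1 := (integrable_exp_mul_gaussianReal (μ := 0) (v := 1) (c * s)).const_mul
    (Real.exp (m * h))
  have i2 := (integrable_exp_mul_gaussianReal (μ := 0) (v := 1) (-(c * s))).const_mul
    (Real.exp (-(m * h)))
  have i3 : Integrable (fun g => Real.exp (-(c * |s * g + m * h / c|))) (gaussianReal 0 1) :=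
    integrable_exp_neg_abs q m c h hc
  simp_rw [key]
  rw [integral_sub (by exact i1.add i2) i3, integral_add i1 i2, integral_const_mul, integral_const_mul,
    integral_exp_mul_stdGaussian, integral_exp_mul_stdGaussian, neg_sq, hs2, mul_sub,
    ← mul_assoc _ (Real.exp (-((c ^ 2 - q) / 2))), ← Real.exp_add ((c ^ 2 - q) / 2),
    add_neg_cancel, Real.exp_zero, one_mul, Real.cosh_eq]
  unfold expNegAbsMean
  ring

theorem log_two_cosh_le (x : ℝ) : Real.log (2 * Real.cosh x) ≤ Real.log 2 + |x| := by
  rw [Real.log_mul two_ne_zero (Real.cosh_pos x).ne']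
  gcongr
  rw [Real.log_le_iff_le_exp (Real.cosh_pos x), Real.cosh_eq]
  have h1 := Real.exp_le_exp.2 (le_abs_self x)
  have h2 := Real.exp_le_exp.2 (neg_le_abs x)
  linarith

theorem integrable_id_stdGaussian : Integrable (fun x : ℝ => x) (gaussianReal 0 1) :=
  memLp_one_iff_integrable.1 (by exact_mod_cast memLp_id_gaussianReal (μ := 0) (v := 1) 1)

theorem integrable_sq_stdGaussian : Integrable (fun x : ℝ => x ^ 2) (gaussianReal 0 1) :=
  MemLp.integrable_sq (by exact_mod_cast memLp_id_gaussianReal (μ := 0) (v := 1) 2)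

theorem log_two_cosh_sub_mem (q m c h : ℝ) (hc : 0 < c) (hqc : q ≤ c ^ 2) :
    0 ≤ Real.log (2 * Real.cosh (m * h) - Real.exp (-((c ^ 2 - q) / 2)) * expNegAbsMean q m c h) ∧
    Real.log (2 * Real.cosh (m * h) - Real.exp (-((c ^ 2 - q) / 2)) * expNegAbsMean q m c h) ≤
      Real.log 2 + |m * h| := by
  have h0 : 0 ≤ Real.exp (-((c ^ 2 - q) / 2)) * expNegAbsMean q m c h :=
    mul_nonneg (Real.exp_pos _).le (expNegAbsMean_nonneg ..)
  have h1 : Real.exp (-((c ^ 2 - q) / 2)) * expNegAbsMean q m c h ≤ 1 :=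
    mul_le_one₀ (Real.exp_le_one_iff.2 (by linarith)) (expNegAbsMean_nonneg ..)
      (expNegAbsMean_le_one _ _ _ _ hc)
  have h2 := Real.one_le_cosh (m * h)
  refine ⟨Real.log_nonneg (by linarith), le_trans ?_ (log_two_cosh_le _)⟩
  exact Real.log_le_log (by linarith) (by linarith)

theorem integrable_log_two_add_abs (m : ℝ) :
    Integrable (fun h : ℝ => Real.log 2 + |m * h|) (gaussianReal 0 1) :=
  (integrable_const _).add (integrable_id_stdGaussian.const_mul m).abs

theorem aestronglyMeasurable_log_two_cosh_sub (q m c : ℝ) :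
    AEStronglyMeasurable (fun h => Real.log (2 * Real.cosh (m * h) -
      Real.exp (-((c ^ 2 - q) / 2)) * expNegAbsMean q m c h)) (gaussianReal 0 1) := by
  have h1 := (stronglyMeasurable_expNegAbsMean q m c).measurable
  have h2 : Measurable fun h : ℝ => Real.cosh (m * h) :=
    (Real.continuous_cosh.comp (continuous_const_mul m)).measurable
  exact (Real.measurable_log.comp
    ((h2.const_mul 2).sub (h1.const_mul _))).aestronglyMeasurable

theorem integral_log_integral_exp_abs_affine (q m c : ℝ) (hc : 0 < c) (hqc : q ≤ c ^ 2) :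
    ∫ h, Real.log (∫ g, Real.exp (c * |Real.sqrt (1 - q / c ^ 2) * g + m * h / c|)
        ∂(gaussianReal 0 1)) ∂(gaussianReal 0 1) =
      (c ^ 2 - q) / 2 + ∫ h, Real.log (2 * Real.cosh (m * h) -
        Real.exp (-((c ^ 2 - q) / 2)) * expNegAbsMean q m c h) ∂(gaussianReal 0 1) := by
  have hpos : ∀ h, 0 < 2 * Real.cosh (m * h) -
      Real.exp (-((c ^ 2 - q) / 2)) * expNegAbsMean q m c h := by
    intro h
    have h1 : Real.exp (-((c ^ 2 - q) / 2)) * expNegAbsMean q m c h ≤ 1 :=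
      mul_le_one₀ (Real.exp_le_one_iff.2 (by linarith)) (expNegAbsMean_nonneg ..)
        (expNegAbsMean_le_one _ _ _ _ hc)
    have h2 := Real.one_le_cosh (m * h)
    linarith
  have hint : Integrable (fun h => Real.log (2 * Real.cosh (m * h) -
      Real.exp (-((c ^ 2 - q) / 2)) * expNegAbsMean q m c h)) (gaussianReal 0 1) :=
    (integrable_log_two_add_abs m).mono' (aestronglyMeasurable_log_two_cosh_sub q m c)
      (ae_of_all _ fun h => by
        have := log_two_cosh_sub_mem q m c h hc hqc
        rw [Real.norm_of_nonneg this.1]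
        exact this.2)
  have key : ∀ h, Real.log (∫ g, Real.exp (c * |Real.sqrt (1 - q / c ^ 2) * g + m * h / c|)
        ∂(gaussianReal 0 1)) = (c ^ 2 - q) / 2 + Real.log (2 * Real.cosh (m * h) -
        Real.exp (-((c ^ 2 - q) / 2)) * expNegAbsMean q m c h) := by
    intro h
    rw [integral_exp_abs_affine q m c h hc hqc, Real.log_mul (Real.exp_pos _).ne' (hpos h).ne',
      Real.log_exp]
  simp_rw [key]
  rw [integral_add (integrable_const _) hint]
  simp

theorem eventually_pos_and_le_sq (q : ℝ) : ∀ᶠ c : ℝ in atTop, 0 < c ∧ q ≤ c ^ 2 := by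
  filter_upwards [eventually_gt_atTop 0,
    (tendsto_pow_atTop (α := ℝ) two_ne_zero).eventually_ge_atTop q] with c h1 h2
  exact ⟨h1, h2⟩

theorem tendsto_integral_log_two_cosh_sub (q m : ℝ) :
    Tendsto (fun c : ℝ => ∫ h, Real.log (2 * Real.cosh (m * h) -
        Real.exp (-((c ^ 2 - q) / 2)) * expNegAbsMean q m c h) ∂(gaussianReal 0 1)) atTop
      (nhds (∫ h, Real.log (2 * Real.cosh (m * h)) ∂(gaussianReal 0 1))) := by
  refine tendsto_integral_filter_of_dominated_convergence (fun h => Real.log 2 + |m * h|)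
    (Eventually.of_forall fun c => aestronglyMeasurable_log_two_cosh_sub q m c) ?_
    (integrable_log_two_add_abs m) (ae_of_all _ fun h => ?_)
  · filter_upwards [eventually_pos_and_le_sq q] with c hc
    refine ae_of_all _ fun h => ?_
    have := log_two_cosh_sub_mem q m c h hc.1 hc.2
    rw [Real.norm_of_nonneg this.1]
    exact this.2
  · have hexp : Tendsto (fun c : ℝ => Real.exp (-((c ^ 2 - q) / 2))) atTop (nhds 0) := by
      refine Real.tendsto_exp_neg_atTop_nhds_zero.comp ?_
      exact (tendsto_atTop_add_const_right _ (-q)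
        (tendsto_pow_atTop (α := ℝ) two_ne_zero)).atTop_div_const two_pos
    have hr : Tendsto (fun c : ℝ => Real.exp (-((c ^ 2 - q) / 2)) * expNegAbsMean q m c h) atTop
        (nhds 0) := by
      refine squeeze_zero' (Eventually.of_forall fun c =>
        mul_nonneg (Real.exp_pos _).le (expNegAbsMean_nonneg ..)) ?_ hexp
      filter_upwards [eventually_gt_atTop 0] with c hc
      exact mul_le_of_le_one_right (Real.exp_pos _).le (expNegAbsMean_le_one _ _ _ _ hc)
    have hne : 2 * Real.cosh (m * h) ≠ 0 := by
      have := Real.cosh_pos (m * h)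
      positivity
    have := (tendsto_const_nhds (x := 2 * Real.cosh (m * h))).sub hr
    rw [sub_zero] at this
    exact this.log hne

theorem integral_indicator_eq_erfc (a u : ℝ) (ha : 0 < a) :
    ∫ g, Set.indicator {g : ℝ | a * g + u ≤ 0} (fun _ => (1 : ℝ)) g ∂(gaussianReal 0 1) =
      (1 / 2) * erfc (u / (Real.sqrt 2 * a)) := by
  have h2 : (0 : ℝ) < Real.sqrt 2 := by positivity
  have hset : {g : ℝ | a * g + u ≤ 0} = Set.Iic (-(u / a)) := by
    ext g
    simp only [Set.mem_ofPred_eq, Set.mem_Iic]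
    rw [← neg_div, le_div_iff₀ ha]
    constructor <;> intro h <;> linarith
  rw [hset, integral_gaussianReal_eq_integral_smul one_ne_zero]
  have hind : (fun x => gaussianPDFReal 0 1 x • Set.indicator (Set.Iic (-(u / a)))
      (fun _ => (1 : ℝ)) x) = Set.indicator (Set.Iic (-(u / a))) (gaussianPDFReal 0 1) := by
    ext x
    by_cases hx : x ∈ Set.Iic (-(u / a))
    · rw [Set.indicator_of_mem hx, Set.indicator_of_mem hx, smul_eq_mul, mul_one]
    · rw [Set.indicator_of_notMem hx, Set.indicator_of_notMem hx, smul_zero]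
  rw [hind, integral_indicator measurableSet_Iic, ← integral_comp_neg_Ioi]
  have hsc := integral_comp_mul_left_Ioi (fun t => Real.exp (-t ^ 2)) (u / a)
    (inv_pos.2 h2)
  have harg : (Real.sqrt 2)⁻¹ * (u / a) = u / (Real.sqrt 2 * a) := by field_simp
  rw [harg, inv_inv, smul_eq_mul] at hsc
  have hpdf : ∀ x, gaussianPDFReal 0 1 (-x) =
      (Real.sqrt (2 * π))⁻¹ * Real.exp (-((Real.sqrt 2)⁻¹ * x) ^ 2) := by
    intro x
    rw [gaussianPDFReal_def, mul_pow, inv_pow, Real.sq_sqrt two_pos.le]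
    simp only [NNReal.coe_one, mul_one, sub_zero]
    congr 2
    ring
  simp_rw [hpdf]
  rw [integral_const_mul, hsc, erfc, Real.sqrt_mul two_pos.le]
  have : (0 : ℝ) < Real.sqrt π := Real.sqrt_pos.2 Real.pi_pos
  field_simp

theorem exp_neg_sq_le_erfc (x : ℝ) :
    (2 / Real.sqrt π) * Real.exp (-(|x| + 1) ^ 2) ≤ erfc x := by
  unfold erfc
  gcongr
  have hi : Integrable (fun t : ℝ => Real.exp (-t ^ 2)) := by
    simpa using integrable_exp_neg_mul_sq (b := 1) one_pos
  have hsub : Set.Ioc |x| (|x| + 1) ⊆ Set.Ioi x := fun t ht =>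
    lt_of_le_of_lt (le_abs_self x) ht.1
  calc Real.exp (-(|x| + 1) ^ 2)
      = ∫ _ in Set.Ioc |x| (|x| + 1), Real.exp (-(|x| + 1) ^ 2) := by simp
    _ ≤ ∫ t in Set.Ioc |x| (|x| + 1), Real.exp (-t ^ 2) := by
        refine setIntegral_mono_on (integrableOn_const (by simp)) hi.integrableOn
          measurableSet_Ioc fun t ht => ?_
        have h0 : 0 ≤ t := (abs_nonneg x).trans ht.1.le
        have h2 := ht.2
        gcongr
    _ ≤ ∫ t in Set.Ioi x, Real.exp (-t ^ 2) :=
        setIntegral_mono_set hi.integrableOn (ae_of_all _ fun t => (Real.exp_pos _).le)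
          hsub.eventuallyLE

theorem erfc_pos (x : ℝ) : 0 < erfc x :=
  lt_of_lt_of_le (by have := Real.sqrt_pos.2 Real.pi_pos; positivity) (exp_neg_sq_le_erfc x)

theorem neg_log_half_erfc_le (x : ℝ) :
    -Real.log ((1 / 2) * erfc x) ≤ Real.log (Real.sqrt π) + 2 * x ^ 2 + 2 := by
  have hπ : (0 : ℝ) < Real.sqrt π := Real.sqrt_pos.2 Real.pi_pos
  have h1 : (Real.sqrt π)⁻¹ * Real.exp (-(|x| + 1) ^ 2) ≤ (1 / 2) * erfc x := by
    have := exp_neg_sq_le_erfc x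
    have h : (2 / Real.sqrt π) = 2 * (Real.sqrt π)⁻¹ := by ring
    rw [h] at this
    linarith
  have h2 := Real.log_le_log (by positivity) h1
  rw [Real.log_mul (by positivity) (by positivity), Real.log_exp, Real.log_inv] at h2
  nlinarith [sq_nonneg (|x| - 1), sq_abs x]

theorem exp_neg_mul_max_sq_le_one (k y : ℝ) (hk : 0 ≤ k) :
    Real.exp (-k * max y 0 ^ 2) ≤ 1 := by
  rw [Real.exp_le_one_iff]
  have := sq_nonneg (max y 0)
  nlinarith

theorem integrable_exp_neg_mul_max_sq (k a u : ℝ) (hk : 0 ≤ k) :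
    Integrable (fun g => Real.exp (-k * max (a * g + u) 0 ^ 2)) (gaussianReal 0 1) := by
  refine Integrable.mono' (integrable_const (1 : ℝ))
    (by fun_prop : Continuous _).aestronglyMeasurable (ae_of_all _ fun g => ?_)
  rw [Real.norm_eq_abs, Real.abs_exp]
  exact exp_neg_mul_max_sq_le_one _ _ hk

theorem integral_exp_neg_mul_max_sq_mem (k a u : ℝ) (hk : 0 ≤ k) (ha : 0 < a) :
    (1 / 2) * erfc (u / (Real.sqrt 2 * a)) ≤
        ∫ g, Real.exp (-k * max (a * g + u) 0 ^ 2) ∂(gaussianReal 0 1) ∧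
      ∫ g, Real.exp (-k * max (a * g + u) 0 ^ 2) ∂(gaussianReal 0 1) ≤ 1 := by
  have hi := integrable_exp_neg_mul_max_sq k a u hk
  constructor
  · rw [← integral_indicator_eq_erfc a u ha]
    refine integral_mono_of_nonneg
      (ae_of_all _ fun g => Set.indicator_nonneg (fun _ _ => zero_le_one) g) hi
      (ae_of_all _ fun g => Set.indicator_apply_le' (fun hg => ?_) (fun _ => (Real.exp_pos _).le))
    have hg' : a * g + u ≤ 0 := hg
    beta_reduce
    rw [max_eq_right hg']
    simp
  · have := integral_mono hi (integrable_const (μ := gaussianReal 0 1) (1 : ℝ))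
      (fun g => exp_neg_mul_max_sq_le_one k _ hk)
    simpa using this

theorem tendsto_integral_exp_neg_mul_max_sq (a u : ℝ) (ha : 0 < a) :
    Tendsto (fun k : ℝ => ∫ g, Real.exp (-k * max (a * g + u) 0 ^ 2) ∂(gaussianReal 0 1)) atTop
      (nhds ((1 / 2) * erfc (u / (Real.sqrt 2 * a)))) := by
  rw [← integral_indicator_eq_erfc a u ha]
  refine tendsto_integral_filter_of_dominated_convergence (fun _ => 1)
    (Eventually.of_forall fun k => (by fun_prop : Continuous _).aestronglyMeasurable) ?_
    (integrable_const _) (ae_of_all _ fun g => ?_)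
  · filter_upwards [eventually_ge_atTop 0] with k hk
    refine ae_of_all _ fun g => ?_
    rw [Real.norm_eq_abs, Real.abs_exp]
    exact exp_neg_mul_max_sq_le_one _ _ hk
  · by_cases hg : a * g + u ≤ 0
    · rw [Set.indicator_of_mem (s := {g : ℝ | a * g + u ≤ 0}) hg, max_eq_right hg]
      simp
    · rw [Set.indicator_of_notMem (s := {g : ℝ | a * g + u ≤ 0}) hg]
      push Not at hg
      rw [max_eq_left hg.le]
      simp_rw [neg_mul]
      exact Real.tendsto_exp_neg_atTop_nhds_zero.comp
        (tendsto_id.atTop_mul_const (by positivity))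

theorem tendsto_integral_log_integral_exp_neg_mul_max_sq (a b κ : ℝ) (ha : 0 < a) :
    Tendsto (fun k : ℝ => ∫ h, Real.log
        (∫ g, Real.exp (-k * max (a * g + b * h + κ) 0 ^ 2) ∂(gaussianReal 0 1))
        ∂(gaussianReal 0 1)) atTop
      (nhds (∫ h, Real.log ((1 / 2) * erfc ((b * h + κ) / (Real.sqrt 2 * a)))
        ∂(gaussianReal 0 1))) := by
  simp_rw [add_assoc]
  refine tendsto_integral_filter_of_dominated_convergence
    (fun h => Real.log (Real.sqrt π) + 2 * ((b * h + κ) / (Real.sqrt 2 * a)) ^ 2 + 2)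
    (Eventually.of_forall fun k => ?_) ?_ ?_ (ae_of_all _ fun h => ?_)
  · have : StronglyMeasurable fun h => ∫ g, Real.exp (-k * max (a * g + (b * h + κ)) 0 ^ 2)
        ∂(gaussianReal 0 1) := by
      apply StronglyMeasurable.integral_prod_right
      apply Continuous.stronglyMeasurable
      unfold Function.uncurry
      fun_prop
    exact (Real.measurable_log.comp this.measurable).aestronglyMeasurable
  · filter_upwards [eventually_ge_atTop 0] with k hk
    refine ae_of_all _ fun h => ?_
    obtain ⟨h1, h2⟩ := integral_exp_neg_mul_max_sq_mem k a (b * h + κ) hk ha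
    have h0 : 0 < (1 / 2) * erfc ((b * h + κ) / (Real.sqrt 2 * a)) := by
      have := erfc_pos ((b * h + κ) / (Real.sqrt 2 * a))
      positivity
    rw [Real.norm_of_nonpos (Real.log_nonpos (h0.le.trans h1) h2)]
    exact (neg_le_neg (Real.log_le_log h0 h1)).trans (neg_log_half_erfc_le _)
  · have hsq : (fun h : ℝ => Real.log (Real.sqrt π) +
        2 * ((b * h + κ) / (Real.sqrt 2 * a)) ^ 2 + 2) = fun h =>
        (2 * (b / (Real.sqrt 2 * a)) ^ 2) * h ^ 2 +
        (4 * (b / (Real.sqrt 2 * a)) * (κ / (Real.sqrt 2 * a))) * h +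
        (Real.log (Real.sqrt π) + 2 * (κ / (Real.sqrt 2 * a)) ^ 2 + 2) := by
      ext h
      ring
    rw [hsq]
    exact ((integrable_sq_stdGaussian.const_mul _).add
      (integrable_id_stdGaussian.const_mul _)).add (integrable_const _)
  · refine (tendsto_integral_exp_neg_mul_max_sq a (b * h + κ) ha).log ?_
    have := erfc_pos ((b * h + κ) / (Real.sqrt 2 * a))
    positivity

/-- Fix `p ∈ (0,1)`, `q > 0`, `κ ∈ ℝ`, `α > 0`; let `g`, `h` be independent
standard Gaussians. Then, as `c → ∞` over `c > √q`, the scaled second-level lifted random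
dual expression
`c ((c/2)(1 - pq/c²) - (1/c) 𝔼_h[log 𝔼_g[exp(c |√(1-q/c²) g + √q h/c|)]] + 1/c²
  - (α/c) 𝔼_h[log 𝔼_g[exp(-(c³/4) max(√(1-p) g + √p h + κ, 0)²)]])`
converges to
`((1-p) q)/2 - 𝔼_h[log(2 cosh(√q h))] - α 𝔼_h[log((1/2) erfc((√p h + κ)/√(2(1-p))))]`. -/
theorem second_level_lifted_dual_limit (p q κ α : ℝ)
    (hp : p ∈ Set.Ioo (0 : ℝ) 1) (hq : 0 < q) (hα : 0 < α) :
    Tendsto (fun c : ℝ => c *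
        ((c / 2) * (1 - p * q / c ^ 2) -
          (1 / c) * (∫ h, Real.log
            (∫ g, Real.exp (c * |Real.sqrt (1 - q / c ^ 2) * g + Real.sqrt q * h / c|)
              ∂(gaussianReal 0 1)) ∂(gaussianReal 0 1)) +
          1 / c ^ 2 -
          (α / c) * ∫ h, Real.log
            (∫ g, Real.exp (-(c ^ 3 / 4) *
                max (Real.sqrt (1 - p) * g + Real.sqrt p * h + κ) 0 ^ 2)
              ∂(gaussianReal 0 1)) ∂(gaussianReal 0 1)))
      (atTop ⊓ Filter.principal (Set.Ioi (Real.sqrt q)))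
      (nhds (((1 - p) * q) / 2 -
        (∫ h, Real.log (2 * Real.cosh (Real.sqrt q * h)) ∂(gaussianReal 0 1)) -
        α * ∫ h, Real.log
          ((1 / 2) * erfc ((Real.sqrt p * h + κ) / Real.sqrt (2 * (1 - p))))
          ∂(gaussianReal 0 1))) := by
  refine Tendsto.mono_left ?_ inf_le_left
  have ha : 0 < Real.sqrt (1 - p) := Real.sqrt_pos.2 (by linarith [hp.2])
  have hcube : Tendsto (fun c : ℝ => c ^ 3 / 4) atTop atTop :=
    (tendsto_pow_atTop (α := ℝ) three_ne_zero).atTop_div_const (by norm_num)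
  have h1 := tendsto_integral_log_two_cosh_sub q (Real.sqrt q)
  have h2 := (tendsto_integral_log_integral_exp_neg_mul_max_sq (Real.sqrt (1 - p)) (Real.sqrt p) κ
    ha).comp hcube
  rw [Real.sqrt_mul two_pos.le]
  have h3 := (((tendsto_const_nhds (x := (1 - p) * q / 2)).sub h1).add
    (tendsto_inv_atTop_zero (𝕜 := ℝ))).sub (h2.const_mul α)
  rw [add_zero] at h3
  refine h3.congr' ?_
  filter_upwards [eventually_pos_and_le_sq q] with c hc
  rw [integral_log_integral_exp_abs_affine q (Real.sqrt q) c hc.1 hc.2]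
  have := hc.1.ne'
  simp only [Function.comp_apply]
  field_simp
  ring
end
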